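/- arXiv:quant-ph/0402154 — 2 statements merged into one kernel-verified Lean document; each statement's English description precedes it below -/
import Mathlib

section
/- The explicit matrix V₋(u) := (2ε(u)(ε(u)+mc²))^(−1/2)·[ u·σ ; −(ε(u)+mc²)·I₂ ] (a 4×2 complex matrix written in two 2×2 blocks, upper block u·σ and lower block −(ε(u)+mc²)·I₂) is an isometry onto the anti-particle eigenspace: V₋(u)ᴴ·V₋(u) = I₂, V₋(u)·V₋(u)ᴴ = Π₋(u), and H(u,a)·V₋(u) = h₋(u,a)·V₋(u) for every u ∈ ℝ³ and a ∈ ℝ. -/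
open Matrix Complex

noncomputable section

/-- The Pauli matrices `σ₁, σ₂, σ₃` as `2 × 2` complex matrices. -/
def pauli : Fin 3 → Matrix (Fin 2) (Fin 2) ℂ
  | 0 => !![0, 1; 1, 0]
  | 1 => !![0, -Complex.I; Complex.I, 0]
  | 2 => !![1, 0; 0, -1]

/-- The Dirac matrices `α_k = fromBlocks 0 σ_k σ_k 0`. -/
def diracAlpha (k : Fin 3) : Matrix (Fin 2 ⊕ Fin 2) (Fin 2 ⊕ Fin 2) ℂ :=
  Matrix.fromBlocks 0 (pauli k) (pauli k) 0

/-- The Dirac matrix `β = fromBlocks I₂ 0 0 (-I₂)`. -/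
def diracBeta : Matrix (Fin 2 ⊕ Fin 2) (Fin 2 ⊕ Fin 2) ℂ :=
  Matrix.fromBlocks 1 0 0 (-1)

/-- `ε(u) = √(‖u‖² + m²c⁴)`. -/
def diracEps (m c : ℝ) (u : EuclideanSpace ℝ (Fin 3)) : ℝ :=
  Real.sqrt (‖u‖ ^ 2 + m ^ 2 * c ^ 4)

/-- The Dirac symbol matrix `H(u,a) = u·α + mc²β + a·I₄`. -/
def diracSymbol (m c : ℝ) (u : EuclideanSpace ℝ (Fin 3)) (a : ℝ) :
    Matrix (Fin 2 ⊕ Fin 2) (Fin 2 ⊕ Fin 2) ℂ :=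
  (u 0 : ℂ) • diracAlpha 0 + (u 1 : ℂ) • diracAlpha 1 + (u 2 : ℂ) • diracAlpha 2 +
    ((m * c ^ 2 : ℝ) : ℂ) • diracBeta + ((a : ℝ) : ℂ) • (1 : Matrix (Fin 2 ⊕ Fin 2) (Fin 2 ⊕ Fin 2) ℂ)

/-- The eigenprojection symbols `Π±(u) = ½(I₄ ± ε(u)⁻¹(u·α + mc²β))`. -/
def diracProj (m c : ℝ) (s : Bool) (u : EuclideanSpace ℝ (Fin 3)) :
    Matrix (Fin 2 ⊕ Fin 2) (Fin 2 ⊕ Fin 2) ℂ :=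
  (1 / 2 : ℂ) • ((1 : Matrix (Fin 2 ⊕ Fin 2) (Fin 2 ⊕ Fin 2) ℂ) +
    (if s then 1 else -1 : ℂ) • (((diracEps m c u)⁻¹ : ℝ) : ℂ) •
      ((u 0 : ℂ) • diracAlpha 0 + (u 1 : ℂ) • diracAlpha 1 + (u 2 : ℂ) • diracAlpha 2 +
        ((m * c ^ 2 : ℝ) : ℂ) • diracBeta))


/-- `v·σ = v₁σ₁ + v₂σ₂ + v₃σ₃`. -/
def pauliVec (v : EuclideanSpace ℝ (Fin 3)) : Matrix (Fin 2) (Fin 2) ℂ :=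
  (v 0 : ℂ) • pauli 0 + (v 1 : ℂ) • pauli 1 + (v 2 : ℂ) • pauli 2

/-- The isometry `V₋(u)` onto the anti-particle eigenspace, a `4 × 2` matrix with
upper block `u·σ` and lower block `-(ε(u)+mc²)·I₂`, normalised by
`(2ε(u)(ε(u)+mc²))^(-1/2)`. -/
def diracVminus (m c : ℝ) (u : EuclideanSpace ℝ (Fin 3)) :
    Matrix (Fin 2 ⊕ Fin 2) (Fin 2) ℂ :=
  (((Real.sqrt (2 * diracEps m c u * (diracEps m c u + m * c ^ 2)))⁻¹ : ℝ) : ℂ) •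
    Matrix.fromRows (pauliVec u)
      (-(((diracEps m c u + m * c ^ 2 : ℝ) : ℂ) • (1 : Matrix (Fin 2) (Fin 2) ℂ)))

theorem pauliVec_eq_of (v : EuclideanSpace ℝ (Fin 3)) :
    pauliVec v = !![(v 2 : ℂ), v 0 - v 1 * Complex.I; v 0 + v 1 * Complex.I, -(v 2 : ℂ)] := by
  ext i j
  fin_cases i <;> fin_cases j <;> simp [pauliVec, pauli, sub_eq_add_neg]

theorem pauliVec_conjTranspose (v : EuclideanSpace ℝ (Fin 3)) : (pauliVec v)ᴴ = pauliVec v := by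
  rw [pauliVec_eq_of]
  ext i j
  fin_cases i <;> fin_cases j <;> simp [sub_eq_add_neg]

theorem pauliVec_mul_self (v : EuclideanSpace ℝ (Fin 3)) :
    pauliVec v * pauliVec v = ((‖v‖ ^ 2 : ℝ) : ℂ) • (1 : Matrix (Fin 2) (Fin 2) ℂ) := by
  have hI : Complex.I ^ 2 = -1 := Complex.I_sq
  rw [EuclideanSpace.real_norm_sq_eq, Fin.sum_univ_three, pauliVec_eq_of]
  ext i j
  fin_cases i <;> fin_cases j <;> simp [Matrix.mul_apply, Fin.sum_univ_two] <;>
    first | ring1 | linear_combination (-(v 1 : ℂ) ^ 2) * hI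

/-- The free Dirac matrix `u·α + bβ` in block form. -/
theorem diracAlpha_sum_add_beta (b : ℂ) (u : EuclideanSpace ℝ (Fin 3)) :
    (u 0 : ℂ) • diracAlpha 0 + (u 1 : ℂ) • diracAlpha 1 + (u 2 : ℂ) • diracAlpha 2 +
      b • diracBeta = fromBlocks (b • 1) (pauliVec u) (pauliVec u) (-(b • 1)) := by
  simp [diracAlpha, diracBeta, pauliVec, fromBlocks_smul, fromBlocks_add]

theorem diracEps_sq (m c : ℝ) (u : EuclideanSpace ℝ (Fin 3)) :
    diracEps m c u ^ 2 = ‖u‖ ^ 2 + (m * c ^ 2) ^ 2 := by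
  rw [diracEps, Real.sq_sqrt (by positivity)]
  ring

theorem diracEps_pos {m c : ℝ} (hm : 0 < m) (hc : 0 < c) (u : EuclideanSpace ℝ (Fin 3)) :
    0 < diracEps m c u :=
  Real.sqrt_pos.2 (by positivity)

/-- `V₋(u)` is an isometry onto the anti-particle eigenspace:
`V₋ᴴV₋ = I₂`, `V₋V₋ᴴ = Π₋(u)` and `H(u,a)V₋ = h₋(u,a)V₋`. -/
theorem diracVminus_isometry (m c : ℝ) (hm : 0 < m) (hc : 0 < c)
    (u : EuclideanSpace ℝ (Fin 3)) (a : ℝ) :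
    (diracVminus m c u)ᴴ * diracVminus m c u = 1 ∧
    diracVminus m c u * (diracVminus m c u)ᴴ = diracProj m c false u ∧
    diracSymbol m c u a * diracVminus m c u
      = ((a - diracEps m c u : ℝ) : ℂ) • diracVminus m c u := by
  have hE := diracEps_pos hm hc u
  have hsq := diracEps_sq m c u
  have hb : 0 < m * c ^ 2 := by positivity
  have hP := pauliVec_mul_self u
  have hPH := pauliVec_conjTranspose u
  unfold diracSymbol diracProj diracVminus
  rw [diracAlpha_sum_add_beta]
  generalize diracEps m c u = E at *
  generalize m * c ^ 2 = b at *
  generalize pauliVec u = P at *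
  generalize ‖u‖ ^ 2 = s at *
  obtain rfl : s = E ^ 2 - b ^ 2 := by linarith
  have hN : (√(2 * E * (E + b)))⁻¹ * (√(2 * E * (E + b)))⁻¹ = (2 * E * (E + b))⁻¹ := by
    rw [← mul_inv, Real.mul_self_sqrt (by positivity)]
  generalize (√(2 * E * (E + b)))⁻¹ = N at *
  replace hN : (N : ℂ) * N = (2 * E * (E + b))⁻¹ := mod_cast hN
  have hE' : (E : ℂ) ≠ 0 := mod_cast hE.ne'
  have hk' : (E : ℂ) + b ≠ 0 := mod_cast (add_pos hE hb).ne'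
  have hH : ((N : ℂ) • fromRows P (-(((E + b : ℝ) : ℂ) • (1 : Matrix (Fin 2) (Fin 2) ℂ))))ᴴ =
      (N : ℂ) • fromCols P (-(((E + b : ℝ) : ℂ) • (1 : Matrix (Fin 2) (Fin 2) ℂ))) := by
    simp [conjTranspose_smul, conjTranspose_fromRows_eq_fromCols_conjTranspose, hPH]
  rw [hH]
  refine ⟨?_, ?_, ?_⟩
  · rw [Matrix.smul_mul, Matrix.mul_smul, smul_smul, fromCols_mul_fromRows, hP, hN]
    simp only [Matrix.neg_mul, Matrix.mul_neg, Matrix.smul_mul, Matrix.mul_smul, Matrix.one_mul]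
    match_scalars
    simp
    field_simp
    ring
  · rw [Matrix.smul_mul, Matrix.mul_smul, smul_smul, fromRows_mul_fromCols, hP, hN, ← fromBlocks_one]
    simp only [fromBlocks_smul, fromBlocks_add, Matrix.one_mul, Matrix.mul_one,
      Matrix.mul_neg, Matrix.neg_mul, Matrix.mul_smul, Matrix.smul_mul, fromBlocks_inj]
    push_cast
    refine ⟨?_, ?_, ?_, ?_⟩ <;> match_scalars <;> simp <;> field_simp <;> ring
  · rw [Matrix.mul_smul, smul_comm _ (N : ℂ), Matrix.add_mul, Matrix.smul_mul, Matrix.one_mul,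
      fromBlocks_mul_fromRows, hP]
    congr 1
    ext (i | i) j <;> simp <;> ring

end
end

section
/- The projected velocity equals the quantisation of the classical relativistic velocity: for every p ∈ ℝ³ and k = 1,2,3, P₀₊(p)·(c·α_k)·P₀₊(p) = c²·p_k·H₀(p)⁻¹·P₀₊(p) and P₀₋(p)·(c·α_k)·P₀₋(p) = c²·p_k·H₀(p)⁻¹·P₀₋(p). -/
open Matrix Complex

noncomputable section

/-- The free Dirac symbol `H₀(p) = c(p₁α₁ + p₂α₂ + p₃α₃) + mc²β`. -/
def freeDirac (m c : ℝ) (p : EuclideanSpace ℝ (Fin 3)) :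
    Matrix (Fin 2 ⊕ Fin 2) (Fin 2 ⊕ Fin 2) ℂ :=
  ((c * p 0 : ℝ) : ℂ) • diracAlpha 0 + ((c * p 1 : ℝ) : ℂ) • diracAlpha 1 +
    ((c * p 2 : ℝ) : ℂ) • diracAlpha 2 + ((m * c ^ 2 : ℝ) : ℂ) • diracBeta

/-- `ε₀(p) = √(c²‖p‖² + m²c⁴)`. -/
def freeEps (m c : ℝ) (p : EuclideanSpace ℝ (Fin 3)) : ℝ :=
  Real.sqrt (c ^ 2 * ‖p‖ ^ 2 + m ^ 2 * c ^ 4)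

/-- The spectral projection symbols `P₀± (p) = ½(I₄ ± ε₀(p)⁻¹ H₀(p))`. -/
def freeProj (m c : ℝ) (s : Bool) (p : EuclideanSpace ℝ (Fin 3)) :
    Matrix (Fin 2 ⊕ Fin 2) (Fin 2 ⊕ Fin 2) ℂ :=
  (1 / 2 : ℂ) • ((1 : Matrix (Fin 2 ⊕ Fin 2) (Fin 2 ⊕ Fin 2) ℂ) +
    (if s then 1 else -1 : ℂ) • (((freeEps m c p)⁻¹ : ℝ) : ℂ) • freeDirac m c p)

/-- The Clifford relation `α_k H₀(p) + H₀(p) α_k = 2 c p_k`. -/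
lemma diracAlpha_mul_freeDirac_add (m c : ℝ) (p : EuclideanSpace ℝ (Fin 3)) (k : Fin 3) :
    diracAlpha k * freeDirac m c p + freeDirac m c p * diracAlpha k
      = (2 * (c * p k : ℝ) : ℂ) • (1 : Matrix (Fin 2 ⊕ Fin 2) (Fin 2 ⊕ Fin 2) ℂ) := by
  fin_cases k <;> ext (i | i) (j | j) <;> fin_cases i <;> fin_cases j <;>
    simp [freeDirac, diracAlpha, diracBeta, pauli, Matrix.mul_apply, Fin.sum_univ_two,
      Matrix.one_apply] <;> ring_nf <;> simp

lemma freeEps_pos {m c : ℝ} (hm : 0 < m) (hc : 0 < c) (p : EuclideanSpace ℝ (Fin 3)) :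
    0 < freeEps m c p :=
  Real.sqrt_pos.2 (by positivity)

lemma freeEps_sq (m c : ℝ) (p : EuclideanSpace ℝ (Fin 3)) :
    freeEps m c p ^ 2 = c ^ 2 * (p 0 ^ 2 + p 1 ^ 2 + p 2 ^ 2) + m ^ 2 * c ^ 4 := by
  rw [freeEps, Real.sq_sqrt (by positivity), EuclideanSpace.real_norm_sq_eq, Fin.sum_univ_three]

lemma freeDirac_mul_self (m c : ℝ) (p : EuclideanSpace ℝ (Fin 3)) :
    freeDirac m c p * freeDirac m c p
      = ((freeEps m c p : ℂ) ^ 2) • (1 : Matrix (Fin 2 ⊕ Fin 2) (Fin 2 ⊕ Fin 2) ℂ) := by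
  rw [← Complex.ofReal_pow, freeEps_sq]
  ext (i | i) (j | j) <;> fin_cases i <;> fin_cases j <;>
    simp [freeDirac, diracAlpha, diracBeta, pauli, Matrix.mul_apply, Fin.sum_univ_two,
      Matrix.one_apply] <;> ring_nf <;> simp

lemma freeDirac_inv {m c : ℝ} (hm : 0 < m) (hc : 0 < c) (p : EuclideanSpace ℝ (Fin 3)) :
    (freeDirac m c p)⁻¹ = ((freeEps m c p : ℂ) ^ 2)⁻¹ • freeDirac m c p := by
  have he : (freeEps m c p : ℂ) ≠ 0 := Complex.ofReal_ne_zero.2 (freeEps_pos hm hc p).ne'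
  apply Matrix.inv_eq_right_inv
  rw [mul_smul_comm, freeDirac_mul_self, smul_smul, inv_mul_cancel₀ (pow_ne_zero 2 he), one_smul]

/-- If `H² = e²` and `A H + H A = 2t`, then compressing `A` to the range of the projection
`½(1 + s e⁻¹ H)`, `s = ±1`, gives `t H⁻¹` there, where `H⁻¹ = e⁻² H`. -/
lemma proj_mul_mul_proj_of_anticomm {R : Type*} [Ring R] [Algebra ℂ R] {A H : R} {e t s : ℂ}
    (he : e ≠ 0) (hs : s ^ 2 = 1) (hH : H * H = e ^ 2 • (1 : R))
    (hA : A * H + H * A = (2 * t) • (1 : R)) :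
    ((1 / 2 : ℂ) • (1 + s • e⁻¹ • H)) * A * ((1 / 2 : ℂ) • (1 + s • e⁻¹ • H))
      = t • (((e ^ 2)⁻¹ • H) * ((1 / 2 : ℂ) • (1 + s • e⁻¹ • H))) := by
  have hAH : A * H = (2 * t) • (1 : R) - H * A := eq_sub_of_add_eq hA
  have hHAH : H * A * H = (2 * t) • H - e ^ 2 • A := by
    rw [mul_assoc, hAH, mul_sub, ← mul_assoc, hH, mul_smul_comm, mul_one, smul_mul_assoc, one_mul]
  simp only [smul_mul_assoc, mul_smul_comm, add_mul, mul_add, one_mul, mul_one, hHAH, hAH, hH]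
  match_scalars <;> field_simp <;> grind

lemma freeProj_mul_velocity_mul_freeProj {m c : ℝ} (hm : 0 < m) (hc : 0 < c) (s : Bool)
    (p : EuclideanSpace ℝ (Fin 3)) (k : Fin 3) :
    freeProj m c s p * (((c : ℝ) : ℂ) • diracAlpha k) * freeProj m c s p
      = ((c ^ 2 * p k : ℝ) : ℂ) • ((freeDirac m c p)⁻¹ * freeProj m c s p) := by
  have he : (freeEps m c p : ℂ) ≠ 0 := Complex.ofReal_ne_zero.2 (freeEps_pos hm hc p).ne'
  rw [freeDirac_inv hm hc, freeProj, Complex.ofReal_inv]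
  refine proj_mul_mul_proj_of_anticomm he (by cases s <;> simp) (freeDirac_mul_self m c p) ?_
  rw [smul_mul_assoc, mul_smul_comm, ← smul_add, diracAlpha_mul_freeDirac_add, smul_smul]
  congr 1
  push_cast
  ring

/-- the projected velocity equals the quantisation of the classical
relativistic velocity `c²·p_k·H₀(p)⁻¹` on each of the two subspaces. -/
theorem proj_velocity_proj (m c : ℝ) (hm : 0 < m) (hc : 0 < c)
    (p : EuclideanSpace ℝ (Fin 3)) (k : Fin 3) :
    freeProj m c true p * (((c : ℝ) : ℂ) • diracAlpha k) * freeProj m c true p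
        = ((c ^ 2 * p k : ℝ) : ℂ) • ((freeDirac m c p)⁻¹ * freeProj m c true p) ∧
    freeProj m c false p * (((c : ℝ) : ℂ) • diracAlpha k) * freeProj m c false p
        = ((c ^ 2 * p k : ℝ) : ℂ) • ((freeDirac m c p)⁻¹ * freeProj m c false p) := by
  exact ⟨freeProj_mul_velocity_mul_freeProj hm hc true p k,
    freeProj_mul_velocity_mul_freeProj hm hc false p k⟩

end
end
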